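/- Let H be a real Hilbert space, φ : H → ℝ a convex differentiable function whose gradient ∇φ is Lipschitz continuous on bounded subsets of H, A : H → H a maximal monotone operator that is λ-cocoercive for some λ > 0, and γ > 0 with λγ² > 1 and S := (∇φ + A)⁻¹(0) nonempty. Assume moreover that ∇φ + A is strongly monotone over bounded sets. Then for any initial data u₀, v₀ ∈ H, the solution u of ü(t) + γ u̇(t) + ∇φ(u(t)) + A(u(t)) = 0 with u(0) = u₀, u̇(0) = v₀ converges strongly in H, as t → +∞, to the unique element of S. -/

import Mathlib

open Filter MeasureTheory Set Bornology
open scoped RealInnerProductSpace NNReal Topology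

/-- A differentiable convex function lies above its tangent hyperplanes. -/
theorem ConvexOn.add_inner_gradient_le {H : Type*} [NormedAddCommGroup H]
    [InnerProductSpace ℝ H] [CompleteSpace H] {φ : H → ℝ} {g x : H}
    (hφ : ConvexOn ℝ univ φ) (hg : HasGradientAt φ g x) (y : H) :
    φ x + ⟪g, y - x⟫ ≤ φ y := by
  have hconv : ConvexOn ℝ univ (φ ∘ AffineMap.lineMap (k := ℝ) x y) := by
    simpa using hφ.comp_affineMap (AffineMap.lineMap (k := ℝ) x y)
  have hd : HasDerivAt (φ ∘ AffineMap.lineMap (k := ℝ) x y) ⟪g, y - x⟫ 0 := by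
    have hf : HasFDerivAt φ (InnerProductSpace.toDual ℝ H g)
        (AffineMap.lineMap (k := ℝ) x y 0) := by
      simpa using hg.hasFDerivAt
    simpa using hf.comp_hasDerivAt (0 : ℝ) AffineMap.hasDerivAt_lineMap
  have h := hconv.le_slope_of_hasDerivAt (mem_univ 0) (mem_univ 1) one_pos hd
  simp only [slope_def_field, Function.comp_apply, AffineMap.lineMap_apply_zero,
    AffineMap.lineMap_apply_one, sub_zero, div_one] at h
  linarith

/-- The gradient of a convex function is monotone. -/
theorem ConvexOn.inner_gradient_sub_nonneg {H : Type*} [NormedAddCommGroup H]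
    [InnerProductSpace ℝ H] [CompleteSpace H] {φ : H → ℝ} {gx gy x y : H}
    (hφ : ConvexOn ℝ univ φ) (hx : HasGradientAt φ gx x) (hy : HasGradientAt φ gy y) :
    0 ≤ ⟪gx - gy, x - y⟫ := by
  have h₁ := hφ.add_inner_gradient_le hx y
  have h₂ := hφ.add_inner_gradient_le hy x
  rw [← neg_sub x y, inner_neg_right] at h₁
  rw [inner_sub_left]
  linarith

/-- A nonnegative Lipschitz dissipation rate of a Lyapunov function that is bounded below
vanishes at infinity. -/
theorem tendsto_zero_of_lyapunov {W W' g : ℝ → ℝ} {c K : ℝ} (hK : 0 ≤ K)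
    (hW : ∀ t ∈ Ici (0 : ℝ), HasDerivWithinAt W (W' t) (Ici 0) t)
    (hWg : ∀ t ∈ Ici (0 : ℝ), W' t ≤ -g t) (hWc : ∀ t ∈ Ici (0 : ℝ), c ≤ W t)
    (hg : ∀ t ∈ Ici (0 : ℝ), 0 ≤ g t)
    (hgK : ∀ s ∈ Ici (0 : ℝ), ∀ t ∈ Ici (0 : ℝ), |g s - g t| ≤ K * |s - t|) :
    Tendsto g atTop (𝓝 0) := by
  have hanti : AntitoneOn W (Ici 0) := by
    refine antitoneOn_of_hasDerivWithinAt_nonpos (f' := W') (convex_Ici 0)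
      (fun t ht => (hW t ht).continuousWithinAt) (fun t ht => ?_) (fun t ht => ?_)
    · exact (hW t (interior_subset ht)).mono interior_subset
    · linarith [hWg t (interior_subset ht), hg t (interior_subset ht)]
  have hconv : ∃ l, Tendsto W atTop (𝓝 l) := by
    have hanti' : Antitone fun t => W (max t 0) := fun s t hst =>
      hanti (le_max_right s 0) (le_max_right t 0) (max_le_max_right 0 hst)
    have hbdd : BddBelow (range fun t => W (max t 0)) :=
      ⟨c, by rintro _ ⟨t, rfl⟩; exact hWc _ (le_max_right t 0)⟩
    refine ⟨_, (tendsto_atTop_ciInf hanti' hbdd).congr' ?_⟩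
    filter_upwards [eventually_ge_atTop 0] with t ht
    rw [max_eq_left ht]
  obtain ⟨l, hl⟩ := hconv
  rw [Metric.tendsto_nhds]
  intro ε hε
  set τ : ℝ := ε / (2 * (K + 1)) with hτ
  have hτ0 : 0 < τ := by positivity
  have hKτ : K * τ < ε / 2 := by
    have : (K + 1) * τ = ε / 2 := by rw [hτ]; field_simp
    linarith
  have hdiff : Tendsto (fun t => W t - W (t + τ)) atTop (𝓝 0) := by
    simpa using hl.sub (hl.comp (tendsto_atTop_add_const_right atTop τ tendsto_id))
  filter_upwards [eventually_ge_atTop 0,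
    hdiff.eventually_lt_const (show (0 : ℝ) < ε / 2 * τ by positivity)] with t ht hsmall
  have hIcc : Icc t (t + τ) ⊆ Ici 0 := fun s hs => ht.trans hs.1
  have hdrop : W (t + τ) - W t ≤ (K * τ - g t) * (t + τ - t) := by
    have hint : ∀ s ∈ interior (Icc t (t + τ)), HasDerivAt W (W' s) s := fun s hs => by
      rw [interior_Icc] at hs
      exact (hW s (ht.trans hs.1.le)).hasDerivAt (Ici_mem_nhds (ht.trans_lt hs.1))
    refine (convex_Icc t (t + τ)).image_sub_le_mul_sub_of_deriv_le
      (fun s hs => ((hW s (hIcc hs)).mono hIcc).continuousWithinAt)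
      (fun s hs => (hint s hs).differentiableAt.differentiableWithinAt)
      (fun s hs => ?_) t (left_mem_Icc.2 (by linarith)) _ (right_mem_Icc.2 (by linarith))
      (by linarith)
    rw [(hint s hs).deriv]
    have hs' := interior_subset hs
    have h₁ := hgK t ht s (hIcc hs')
    have h₂ : |t - s| ≤ τ := by rw [abs_le]; constructor <;> linarith [hs'.1, hs'.2]
    have h₃ := mul_le_mul_of_nonneg_left h₂ hK
    linarith [hWg s (hIcc hs'), le_abs_self (g t - g s)]
  rw [Real.dist_eq, sub_zero, abs_of_nonneg (hg t ht)]
  by_contra! hge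
  nlinarith

/-- If moreover `∇φ + A` is strongly monotone over bounded sets, then each
trajectory of `ü + γu̇ + ∇φ(u) + A(u) = 0` converges strongly to the unique element of `S`. -/
theorem strong_convergence_strongly_monotone
    {H : Type*} [NormedAddCommGroup H] [InnerProductSpace ℝ H] [CompleteSpace H]
    (φ : H → ℝ) (φ' : H → H) (A : H → H) (lam γ : ℝ)
    (hφconv : ConvexOn ℝ univ φ)
    (hφgrad : ∀ x, HasGradientAt φ (φ' x) x)
    (hφlip : ∀ s : Set H, IsBounded s → ∃ K : ℝ≥0, LipschitzOnWith K φ' s)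
    (hAmono : ∀ v w : H, 0 ≤ ⟪A v - A w, v - w⟫)
    (hAmax : ∀ x y : H, (∀ v : H, 0 ≤ ⟪A v - y, v - x⟫) → y = A x)
    (hlam : 0 < lam)
    (hAcoco : ∀ v w : H, lam * ‖A v - A w‖ ^ 2 ≤ ⟪A v - A w, v - w⟫)
    (hγ : 0 < γ) (hcond : 1 < lam * γ ^ 2)
    (S : Set H) (hS : S = {v : H | φ' v + A v = 0}) (hSne : S.Nonempty)
    (u₀ v₀ : H) (u u' u'' : ℝ → H)
    (hu0 : u 0 = u₀) (hv0 : u' 0 = v₀)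
    (hu : ∀ t ∈ Ici (0:ℝ), HasDerivWithinAt u (u' t) (Ici 0) t)
    (hu' : ∀ t ∈ Ici (0:ℝ), HasDerivWithinAt u' (u'' t) (Ici 0) t)
    (hu''cont : ContinuousOn u'' (Ici 0))
    
    (heq : ∀ t ∈ Ici (0:ℝ), u'' t + γ • u' t + φ' (u t) + A (u t) = 0)
    (hsm : ∀ R : ℝ, 0 < R → ∃ wR : ℝ → ℝ,
      ContinuousOn wR (Ici 0) ∧ (∀ s ∈ Ici (0:ℝ), 0 ≤ wR s) ∧
      (∀ tseq : ℕ → ℝ, (∀ n, 0 ≤ tseq n) →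
        Tendsto (fun n => wR (tseq n)) atTop (𝓝 0) → Tendsto tseq atTop (𝓝 0)) ∧
      (∀ x y : H, ‖x‖ ≤ R → ‖y‖ ≤ R →
        wR ‖x - y‖ ≤ ⟪(φ' x + A x) - (φ' y + A y), x - y⟫)) :
    ∃ p : H, S = {p} ∧ Tendsto u atTop (𝓝 p) := by
  subst hS
  obtain ⟨p, hp⟩ := hSne
  have hp0 : φ' p + A p = 0 := hp
  refine ⟨p, ?_, ?_⟩
  · refine eq_singleton_iff_unique_mem.2 ⟨hp, fun q hq => ?_⟩
    have hq0 : φ' q + A q = 0 := hq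
    obtain ⟨w, -, hw0, hw, hwle⟩ := hsm (‖p‖ + ‖q‖ + 1) (by positivity)
    have hle := hwle q p (by linarith [norm_nonneg p]) (by linarith [norm_nonneg q])
    rw [hp0, hq0, sub_self, inner_zero_left] at hle
    have hzero : w ‖q - p‖ = 0 := le_antisymm hle (hw0 _ (norm_nonneg _))
    have hlim := hw (fun _ => ‖q - p‖) (fun _ => norm_nonneg _)
      (by simp only [hzero]; exact tendsto_const_nhds)
    exact sub_eq_zero.1 (norm_eq_zero.1 (tendsto_const_nhds_iff.1 hlim))
  set F : H → H := fun x => φ' x + A x with hF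
  have hcoco : ∀ x, lam * ‖A x - A p‖ ^ 2 ≤ ⟪F x, x - p⟫ := fun x => by
    have h₁ := hφconv.inner_gradient_sub_nonneg (hφgrad x) (hφgrad p)
    have h₂ : F x = (φ' x - φ' p) + (A x - A p) := by
      rw [← sub_zero (F x), ← hp0]; simp only [hF]; abel
    rw [h₂, inner_add_left]
    linarith [hAcoco x p]
  have hF0 : ∀ x, 0 ≤ ⟪F x, x - p⟫ := fun x => le_trans (by positivity) (hcoco x)
  set W : ℝ → ℝ := fun t => ⟪u' t, u t - p⟫ + γ / 2 * ‖u t - p‖ ^ 2 +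
    2 / γ * (1 / 2 * ‖u' t‖ ^ 2 + (φ (u t) - φ p - ⟪φ' p, u t - p⟫)) with hWdef
  set W' : ℝ → ℝ := fun t => -‖u' t‖ ^ 2 - ⟪F (u t), u t - p⟫ -
    2 / γ * ⟪A (u t) - A p, u' t⟫ with hW'def
  have hW : ∀ t ∈ Ici (0 : ℝ), HasDerivWithinAt W (W' t) (Ici 0) t := fun t ht => by
    have h₁ := (hu t ht).sub_const p
    have h₂ := (hu' t ht).inner ℝ h₁
    have h₃ := (hφgrad (u t)).hasFDerivAt.comp_hasDerivWithinAt t (hu t ht)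
    have h₄ := (hasDerivWithinAt_const t (Ici 0) (φ' p)).inner ℝ h₁
    refine ((h₂.add (h₁.norm_sq.const_mul (γ / 2))).add
      ((((hu' t ht).norm_sq.const_mul (1 / 2)).add
        ((h₃.sub_const (φ p)).sub h₄)).const_mul (2 / γ))).congr_deriv ?_
    have hu'' : u'' t = -(γ • u' t) - φ' (u t) - A (u t) := by
      rw [← sub_zero (u'' t), ← heq t ht]; abel
    have hφp : φ' p = -A p := eq_neg_of_add_eq_zero_left hp0
    simp only [hW'def, hF, hu'', hφp, InnerProductSpace.toDual_apply_apply, inner_add_left,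
      inner_sub_left, inner_sub_right, inner_neg_left, inner_neg_right, inner_smul_left,
      inner_smul_right, inner_zero_left, real_inner_self_eq_norm_sq, RCLike.conj_to_real]
    rw [real_inner_comm (u t) (u' t), real_inner_comm (φ' (u t)) (u' t),
      real_inner_comm (A (u t)) (u' t), real_inner_comm p (u' t)]
    field_simp
    ring
  set δ : ℝ := 1 - 1 / (lam * γ ^ 2) with hδdef
  have hδ : 0 < δ := sub_pos.2 ((div_lt_one (by positivity)).2 hcond)
  have hdiss : ∀ t, W' t ≤ -(δ * ⟪F (u t), u t - p⟫) := fun t => by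
    have h₁ : 0 ≤ ‖u' t‖ ^ 2 + 2 / γ * ⟪A (u t) - A p, u' t⟫ +
        1 / γ ^ 2 * ‖A (u t) - A p‖ ^ 2 := by
      have h := sq_nonneg ‖u' t + (1 / γ) • (A (u t) - A p)‖
      rw [norm_add_sq_real, inner_smul_right, norm_smul, mul_pow, Real.norm_eq_abs, sq_abs,
        real_inner_comm] at h
      calc 0 ≤ _ := h
        _ = _ := by ring
    have h₂ : 1 / γ ^ 2 * ‖A (u t) - A p‖ ^ 2 ≤ (1 - δ) * ⟪F (u t), u t - p⟫ := by
      have h := mul_le_mul_of_nonneg_left (hcoco (u t))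
        (show 0 ≤ 1 / (lam * γ ^ 2) by positivity)
      rw [hδdef, sub_sub_cancel]
      calc _ = 1 / (lam * γ ^ 2) * (lam * ‖A (u t) - A p‖ ^ 2) := by field_simp
        _ ≤ _ := h
    simp only [hW'def]
    linarith
  have hWlow : ∀ t, γ / 4 * ‖u t - p‖ ^ 2 ≤ W t ∧ 1 / (2 * γ) * ‖u' t‖ ^ 2 ≤ W t := fun t => by
    have h₁ := hφconv.add_inner_gradient_le (hφgrad p) (u t)
    have h₂ : 0 ≤ 2 / γ * (φ (u t) - φ p - ⟪φ' p, u t - p⟫) :=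
      mul_nonneg (by positivity) (by linarith)
    have h₃ : 0 ≤ 1 / γ * ‖u' t + (γ / 2) • (u t - p)‖ ^ 2 := by positivity
    have h₄ : 0 ≤ γ / 2 * ‖(1 / γ) • u' t + (u t - p)‖ ^ 2 := by positivity
    rw [norm_add_sq_real, inner_smul_right, norm_smul, mul_pow, Real.norm_eq_abs, sq_abs] at h₃
    rw [norm_add_sq_real, real_inner_smul_left, norm_smul, mul_pow, Real.norm_eq_abs, sq_abs] at h₄
    have e₁ : W t = 1 / γ * (‖u' t‖ ^ 2 + 2 * (γ / 2 * ⟪u' t, u t - p⟫) +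
        (γ / 2) ^ 2 * ‖u t - p‖ ^ 2) + γ / 4 * ‖u t - p‖ ^ 2 +
        2 / γ * (φ (u t) - φ p - ⟪φ' p, u t - p⟫) := by
      simp only [hWdef]; field_simp; ring
    have e₂ : W t = γ / 2 * ((1 / γ) ^ 2 * ‖u' t‖ ^ 2 + 2 * (1 / γ * ⟪u' t, u t - p⟫) +
        ‖u t - p‖ ^ 2) + 1 / (2 * γ) * ‖u' t‖ ^ 2 +
        2 / γ * (φ (u t) - φ p - ⟪φ' p, u t - p⟫) := by
      simp only [hWdef]; field_simp; ring
    constructor <;> linarith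
  have hW0 : ∀ t, 0 ≤ W t := fun t => le_trans (by positivity) (hWlow t).1
  have hWle : ∀ t ∈ Ici (0 : ℝ), W t ≤ W 0 := fun t ht => by
    refine antitoneOn_of_hasDerivWithinAt_nonpos (f' := W') (convex_Ici 0)
      (fun s hs => (hW s hs).continuousWithinAt)
      (fun s hs => (hW s (interior_subset hs)).mono interior_subset) (fun s _ => ?_)
      self_mem_Ici ht ht
    linarith [hdiss s, mul_nonneg hδ.le (hF0 (u s))]
  obtain ⟨R, hR, hRu⟩ : ∃ R, 0 ≤ R ∧ ∀ t ∈ Ici (0 : ℝ), ‖u t - p‖ ≤ R := by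
    refine ⟨√(4 / γ * W 0), Real.sqrt_nonneg _, fun t ht => Real.le_sqrt_of_sq_le ?_⟩
    have h := (hWlow t).1.trans (hWle t ht)
    calc _ = 4 / γ * (γ / 4 * ‖u t - p‖ ^ 2) := by field_simp
      _ ≤ _ := mul_le_mul_of_nonneg_left h (by positivity)
  obtain ⟨M, hM, hMu⟩ : ∃ M, 0 ≤ M ∧ ∀ t ∈ Ici (0 : ℝ), ‖u' t‖ ≤ M := by
    refine ⟨√(2 * γ * W 0), Real.sqrt_nonneg _, fun t ht => Real.le_sqrt_of_sq_le ?_⟩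
    have h := (hWlow t).2.trans (hWle t ht)
    calc _ = 2 * γ * (1 / (2 * γ) * ‖u' t‖ ^ 2) := by field_simp
      _ ≤ _ := mul_le_mul_of_nonneg_left h (by positivity)
  obtain ⟨L, hL, hFL⟩ : ∃ L, 0 ≤ L ∧ ∀ x y, ‖x - p‖ ≤ R → ‖y - p‖ ≤ R →
      ‖F x - F y‖ ≤ L * ‖x - y‖ := by
    obtain ⟨K, hK⟩ := hφlip (Metric.closedBall p R) Metric.isBounded_closedBall
    refine ⟨K + 1 / lam, by positivity, fun x y hx hy => ?_⟩
    have h₁ := hK.norm_sub_le (mem_closedBall_iff_norm.2 hx) (mem_closedBall_iff_norm.2 hy)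
    have h₂ : ‖A x - A y‖ ≤ 1 / lam * ‖x - y‖ := by
      rw [one_div_mul_eq_div, le_div_iff₀ hlam]
      have h₃ := (hAcoco x y).trans (real_inner_le_norm _ _)
      rcases (norm_nonneg (A x - A y)).eq_or_lt with h | h
      · rw [← h]; simp
      · nlinarith
    calc ‖F x - F y‖ = ‖(φ' x - φ' y) + (A x - A y)‖ := by
          simp only [hF]; congr 1; abel
      _ ≤ ‖φ' x - φ' y‖ + ‖A x - A y‖ := norm_add_le _ _
      _ ≤ (K + 1 / lam) * ‖x - y‖ := by linarith
  have huLip : ∀ s ∈ Ici (0 : ℝ), ∀ t ∈ Ici (0 : ℝ), ‖u s - u t‖ ≤ M * |s - t| :=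
    fun s hs t ht => (convex_Ici 0).norm_image_sub_le_of_norm_hasDerivWithin_le hu hMu ht hs
  have hGLip : ∀ s ∈ Ici (0 : ℝ), ∀ t ∈ Ici (0 : ℝ),
      |δ * ⟪F (u s), u s - p⟫ - δ * ⟪F (u t), u t - p⟫| ≤ δ * (2 * L * R * M) * |s - t| := by
    intro s hs t ht
    have hsplit : ⟪F (u s), u s - p⟫ - ⟪F (u t), u t - p⟫ =
        ⟪F (u s) - F (u t), u s - p⟫ + ⟪F (u t), u s - u t⟫ := by
      simp only [inner_sub_left, inner_sub_right]; ring
    have hFp : F p = 0 := hp0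
    have h₁ : |⟪F (u s) - F (u t), u s - p⟫| ≤ L * ‖u s - u t‖ * R :=
      (abs_real_inner_le_norm _ _).trans (mul_le_mul (hFL _ _ (hRu s hs) (hRu t ht))
        (hRu s hs) (norm_nonneg _) (by positivity))
    have h₂ : ‖F (u t)‖ ≤ L * R := by
      have h := hFL (u t) p (hRu t ht) (by simpa using hR)
      rw [hFp, sub_zero] at h
      exact h.trans (mul_le_mul_of_nonneg_left (hRu t ht) hL)
    have h₃ : |⟪F (u t), u s - u t⟫| ≤ L * R * ‖u s - u t‖ :=
      (abs_real_inner_le_norm _ _).trans (mul_le_mul_of_nonneg_right h₂ (norm_nonneg _))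
    have h₄ : 2 * L * R * ‖u s - u t‖ ≤ 2 * L * R * (M * |s - t|) :=
      mul_le_mul_of_nonneg_left (huLip s hs t ht) (by positivity)
    rw [← mul_sub, abs_mul, abs_of_pos hδ, hsplit, mul_assoc δ]
    refine mul_le_mul_of_nonneg_left ((abs_add_le _ _).trans ?_) hδ.le
    linarith
  have hG : Tendsto (fun t => ⟪F (u t), u t - p⟫) atTop (𝓝 0) := by
    have h := tendsto_zero_of_lyapunov (by positivity) hW (fun t _ => hdiss t)
      (fun t _ => hW0 t) (fun t _ => mul_nonneg hδ.le (hF0 (u t))) hGLip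
    simpa [hδ.ne'] using h.const_mul δ⁻¹
  obtain ⟨w, -, hw0, hw, hwle⟩ := hsm (R + ‖p‖ + 1) (by positivity)
  have hwG : ∀ t ∈ Ici (0 : ℝ), w ‖u t - p‖ ≤ ⟪F (u t), u t - p⟫ := fun t ht => by
    have h := hwle (u t) p (by linarith [hRu t ht, norm_le_norm_sub_add (u t) p]) (by linarith)
    rwa [hp0, sub_zero] at h
  have hwlim : Tendsto (fun t => w ‖u t - p‖) atTop (𝓝 0) :=
    squeeze_zero' (Eventually.of_forall fun t => hw0 _ (norm_nonneg _))
      ((eventually_ge_atTop 0).mono hwG) hG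
  rw [tendsto_iff_norm_sub_tendsto_zero]
  exact tendsto_of_seq_tendsto fun x hx =>
    hw (fun n => ‖u (x n) - p‖) (fun n => norm_nonneg _) (hwlim.comp hx)
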